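/- Let s ∈ (0,1) and γ < 0. There exists a constant c > 0, depending only on s and γ, such that for every R > 1 and every measurable g : ℝ³ → ℝ, setting h = 1_{|v|≤R}·g, one has ∫_{ℝ³} ⟨v⟩^γ h(v)² dv + ∬_{ℝ³×ℝ³} (⟨v⟩^{γ/2}h(v) − ⟨v'⟩^{γ/2}h(v'))² / |v−v'|^{3+2s} dv dv' ≥ c·R^{γ(2−s)} · ( ∫_{ℝ³} h(v)² dv + ∬_{ℝ³×ℝ³} (h(v) − h(v'))² / |v−v'|^{3+2s} dv dv' ). -/

import Mathlib

open MeasureTheory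

/-- The Japanese bracket `⟨v⟩ = (1 + |v|²)^{1/2}`. -/
noncomputable def jap {d : ℕ} (v : EuclideanSpace ℝ (Fin d)) : ℝ :=
  Real.sqrt (1 + ‖v‖ ^ 2)


lemma aux_phi_finite (s : ℝ) (hs : s ∈ Set.Ioo (0:ℝ) 1) :
    (∫⁻ z : EuclideanSpace ℝ (Fin 3),
      ENNReal.ofReal (min 1 (‖z‖ ^ 2) / ‖z‖ ^ (3 + 2 * s))) ≠ ⊤ := by
  obtain ⟨h0, h1⟩ := hs
  have hint : Integrable (fun z : EuclideanSpace ℝ (Fin 3) =>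
      min 1 (‖z‖ ^ 2) / ‖z‖ ^ (3 + 2 * s)) := by
    rw [integrable_fun_norm_addHaar (volume : Measure (EuclideanSpace ℝ (Fin 3)))
      (f := fun r : ℝ => min 1 (r ^ 2) / r ^ (3 + 2 * s))]
    rw [← Set.Ioc_union_Ioi_eq_Ioi (zero_le_one (α := ℝ))]
    refine IntegrableOn.union ?_ ?_
    · have := (intervalIntegral.intervalIntegrable_rpow' (a := 0) (b := 1)
        (r := 1 - 2 * s) (by linarith))
      rw [intervalIntegrable_iff_integrableOn_Ioc_of_le zero_le_one] at this
      refine this.congr_fun ?_ measurableSet_Ioc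
      rintro r ⟨hr0, hr1⟩
      have : min 1 (r ^ 2) = r ^ 2 := min_eq_right (by nlinarith)
      simp only [this, finrank_euclideanSpace, Fintype.card_fin, smul_eq_mul]
      rw [show (1 - 2 * s) = ((4:ℕ):ℝ) - (3 + 2 * s) by push_cast; ring, Real.rpow_sub hr0,
        Real.rpow_natCast]
      ring
    · refine (integrableOn_Ioi_rpow_of_lt (a := -1 - 2 * s) (by linarith)
        one_pos).congr_fun ?_ measurableSet_Ioi
      intro r hr
      have hr : 1 < r := hr
      have hr0 : 0 < r := by linarith
      have : min 1 (r ^ 2) = 1 := min_eq_left (by nlinarith)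
      simp only [this, finrank_euclideanSpace, Fintype.card_fin, smul_eq_mul]
      rw [show (-1 - 2 * s) = ((2:ℕ):ℝ) - (3 + 2 * s) by push_cast; ring, Real.rpow_sub hr0,
        Real.rpow_natCast]
      ring
  exact hint.lintegral_lt_top.ne

lemma aux_jap_one_le (v : EuclideanSpace ℝ (Fin 3)) : 1 ≤ jap v := by
  unfold jap
  rw [Real.one_le_sqrt]
  nlinarith [sq_nonneg ‖v‖]

lemma aux_jap_le {R : ℝ} (hR : 1 < R) (v : EuclideanSpace ℝ (Fin 3)) (hv : ‖v‖ ≤ R) :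
    jap v ≤ 2 * R := by
  unfold jap
  rw [Real.sqrt_le_left (by linarith)]
  nlinarith [norm_nonneg v]

lemma aux_jap_lip (v w : EuclideanSpace ℝ (Fin 3)) : |jap v - jap w| ≤ ‖v - w‖ := by
  have key : ∀ v w : EuclideanSpace ℝ (Fin 3), jap v ≤ jap w + ‖v - w‖ := by
    intro v w
    have h1 : ‖v‖ ≤ ‖w‖ + ‖v - w‖ := by
      have := norm_add_le w (v - w)
      simpa using this
    have h2 : ‖w‖ ≤ jap w := Real.le_sqrt_of_sq_le (by linarith)
    have h3 : jap w ^ 2 = 1 + ‖w‖ ^ 2 := Real.sq_sqrt (by positivity)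
    have h4 := norm_nonneg (v - w)
    have h5 := norm_nonneg w
    have h6 := norm_nonneg v
    conv_lhs => unfold jap
    rw [Real.sqrt_le_left (by linarith)]
    nlinarith [mul_le_mul_of_nonneg_right h2 h4]
  rw [abs_le]
  have h1 := key v w
  have h2 := key w v
  rw [norm_sub_rev] at h2
  constructor <;> linarith

lemma aux_rpow_diff {a T x y : ℝ} (ha : 0 < a) (hx : 1 ≤ x) (hxT : x ≤ T)
    (hy : 1 ≤ y) (hyT : y ≤ T) : |x ^ a - y ^ a| ≤ a * T ^ a * |x - y| := by
  have := Convex.norm_image_sub_le_of_norm_hasDerivWithin_le (s := Set.Icc 1 T)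
    (f := fun t : ℝ => t ^ a) (f' := fun t => a * t ^ (a - 1)) (C := a * T ^ a) (x := y) (y := x)
    ?_ ?_ (convex_Icc _ _) ⟨hy, hyT⟩ ⟨hx, hxT⟩
  · simpa [Real.norm_eq_abs] using this
  · rintro t ⟨ht, -⟩
    exact (Real.hasDerivAt_rpow_const (Or.inl (by linarith))).hasDerivWithinAt
  · rintro t ⟨ht, htT⟩
    have ht0 : 0 < t := by linarith
    rw [Real.norm_eq_abs, abs_of_nonneg (by positivity)]
    gcongr
    calc t ^ (a - 1) ≤ t ^ a := Real.rpow_le_rpow_of_exponent_le ht (by linarith)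
      _ ≤ T ^ a := by gcongr

/-- bound with the truncated increment -/
lemma aux_weight {a R : ℝ} (ha : 0 < a) (hR : 1 < R) (v w : EuclideanSpace ℝ (Fin 3))
    (hv : ‖v‖ ≤ R) (hw : ‖w‖ ≤ R) :
    (jap v ^ a - jap w ^ a) ^ 2 ≤ (1 + a) ^ 2 * ((2 * R) ^ a) ^ 2 * min 1 (‖v - w‖ ^ 2) := by
  have hv1 := aux_jap_one_le v
  have hw1 := aux_jap_one_le w
  have hv2 := aux_jap_le hR v hv
  have hw2 := aux_jap_le hR w hw
  have hT : 0 < (2 * R) ^ a := Real.rpow_pos_of_pos (by linarith) _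
  set T := (2 * R) ^ a with hTdef
  rw [← sq_abs]
  have hd := norm_nonneg (v - w)
  rcases min_choice 1 (‖v - w‖ ^ 2) with h | h <;> rw [h]
  · have e1 : jap v ^ a ≤ T := Real.rpow_le_rpow (by linarith) hv2 ha.le
    have e2 : jap w ^ a ≤ T := Real.rpow_le_rpow (by linarith) hw2 ha.le
    have e3 : 0 ≤ jap v ^ a := Real.rpow_nonneg (by linarith) _
    have e4 : 0 ≤ jap w ^ a := Real.rpow_nonneg (by linarith) _
    have : |jap v ^ a - jap w ^ a| ≤ (1 + a) * T := by
      rw [abs_le]; constructor <;> nlinarith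
    calc _ ≤ ((1 + a) * T) ^ 2 := by gcongr
      _ = _ := by ring
  · have : |jap v ^ a - jap w ^ a| ≤ (1 + a) * T * ‖v - w‖ := by
      calc _ ≤ a * T * |jap v - jap w| := aux_rpow_diff ha hv1 hv2 hw1 hw2
        _ ≤ (1 + a) * T * ‖v - w‖ := by
          gcongr
          · linarith
          · exact aux_jap_lip v w
    calc _ ≤ ((1 + a) * T * ‖v - w‖) ^ 2 := by gcongr
      _ = _ := by ring

lemma aux_undo {γ : ℝ} (v : EuclideanSpace ℝ (Fin 3)) (x : ℝ) :
    jap v ^ (-γ / 2) * (jap v ^ (γ / 2) * x) = x := by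
  have hv1 := aux_jap_one_le v
  rw [← mul_assoc, ← Real.rpow_add (by linarith)]
  simp [show -γ / 2 + γ / 2 = 0 by ring]

lemma aux_pow_le {a R : ℝ} (ha : 0 < a) (hR : 1 < R) (v : EuclideanSpace ℝ (Fin 3))
    (hv : ‖v‖ ≤ R) : (jap v ^ a) ^ 2 ≤ ((2 * R) ^ a) ^ 2 := by
  have h1 := aux_jap_one_le v
  have := aux_jap_le hR v hv
  have e3 : 0 ≤ jap v ^ a := Real.rpow_nonneg (by linarith) _
  gcongr

lemma aux_pointwise {γ R : ℝ} (hγ : γ < 0) (hR : 1 < R) (g : EuclideanSpace ℝ (Fin 3) → ℝ)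
    (v w : EuclideanSpace ℝ (Fin 3)) :
    ((if ‖v‖ ≤ R then g v else 0) - (if ‖w‖ ≤ R then g w else 0)) ^ 2 ≤
      2 * ((2 * R) ^ (-γ / 2)) ^ 2 *
        ((jap v ^ (γ / 2) * (if ‖v‖ ≤ R then g v else 0) -
            jap w ^ (γ / 2) * (if ‖w‖ ≤ R then g w else 0)) ^ 2 +
          (1 + -γ / 2) ^ 2 * ((jap v ^ (γ / 2) * (if ‖v‖ ≤ R then g v else 0)) ^ 2 *
            min 1 (‖v - w‖ ^ 2))) := by
  have ha : 0 < -γ / 2 := by linarith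
  have hmin : 0 ≤ min 1 (‖v - w‖ ^ 2) := by positivity
  have main : ∀ F k K m n T e M : ℝ, 0 ≤ M → (n ^ 2 ≤ T ^ 2 ) →
      ((m - n) ^ 2 ≤ (1 + e) ^ 2 * T ^ 2 * M) →
      (m * F - n * K) ^ 2 ≤ 2 * T ^ 2 * ((F - K) ^ 2 + (1 + e) ^ 2 * (F ^ 2 * M)) := by
    intro F k K m n T e M hM h1 h2
    have e1 := mul_le_mul_of_nonneg_right h1 (sq_nonneg (F - K))
    have e2 := mul_le_mul_of_nonneg_right h2 (sq_nonneg F)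
    nlinarith [sq_nonneg (n * (F - K) - (m - n) * F)]
  have triv : ∀ F K m T e M : ℝ, 0 ≤ M → (m ^ 2 ≤ T ^ 2) →
      (m * (F - K)) ^ 2 ≤ 2 * T ^ 2 * ((F - K) ^ 2 + (1 + e) ^ 2 * (F ^ 2 * M)) := by
    intro F K m T e M hM h1
    have e1 := mul_le_mul_of_nonneg_right h1 (sq_nonneg (F - K))
    have e2 : 0 ≤ 2 * T ^ 2 * ((1 + e) ^ 2 * (F ^ 2 * M)) := by positivity
    have e3 : 0 ≤ T ^ 2 * (F - K) ^ 2 := by positivity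
    nlinarith
  by_cases hv : ‖v‖ ≤ R
  · by_cases hw : ‖w‖ ≤ R
    · simp only [hv, hw, if_true]
      have := main (jap v ^ (γ / 2) * g v) 0 (jap w ^ (γ / 2) * g w) (jap v ^ (-γ / 2))
        (jap w ^ (-γ / 2)) ((2 * R) ^ (-γ / 2)) (-γ / 2) _ hmin (aux_pow_le ha hR w hw)
        (aux_weight ha hR v w hv hw)
      rwa [aux_undo, aux_undo] at this
    · simp only [hv, hw, if_true, if_false]
      have := triv (jap v ^ (γ / 2) * g v) (jap w ^ (γ / 2) * 0) (jap v ^ (-γ / 2))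
        ((2 * R) ^ (-γ / 2)) (-γ / 2) _ hmin (aux_pow_le ha hR v hv)
      rw [mul_sub, aux_undo] at this
      simpa only [mul_zero] using this
  · by_cases hw : ‖w‖ ≤ R
    · simp only [hv, hw, if_true, if_false]
      have := triv (jap v ^ (γ / 2) * 0) (jap w ^ (γ / 2) * g w) (jap w ^ (-γ / 2))
        ((2 * R) ^ (-γ / 2)) (-γ / 2) _ hmin (aux_pow_le ha hR w hw)
      rw [mul_sub, aux_undo] at this
      simpa only [mul_zero] using this
    · simp [hv, hw]

lemma aux_sq {γ : ℝ} (v : EuclideanSpace ℝ (Fin 3)) (x : ℝ) :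
    (jap v ^ (γ / 2) * x) ^ 2 = jap v ^ γ * x ^ 2 := by
  have hv1 := aux_jap_one_le v
  rw [mul_pow, ← Real.rpow_natCast, ← Real.rpow_mul (by linarith)]
  norm_num

lemma aux_jap_meas : Measurable (jap : EuclideanSpace ℝ (Fin 3) → ℝ) := by
  unfold jap
  fun_prop

lemma aux_l2 {γ R : ℝ} (hγ : γ < 0) (hR : 1 < R) (g : EuclideanSpace ℝ (Fin 3) → ℝ)
    (v : EuclideanSpace ℝ (Fin 3)) :
    (if ‖v‖ ≤ R then g v else 0) ^ 2 ≤ ((2 * R) ^ (-γ / 2)) ^ 2 *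
      (jap v ^ γ * (if ‖v‖ ≤ R then g v else 0) ^ 2) := by
  by_cases hv : ‖v‖ ≤ R
  · simp only [hv, if_true]
    have h1 := aux_pow_le (a := -γ / 2) (by linarith) hR v hv
    rw [← aux_sq]
    calc g v ^ 2 = (jap v ^ (-γ / 2) * (jap v ^ (γ / 2) * g v)) ^ 2 := by rw [aux_undo]
      _ = (jap v ^ (-γ / 2)) ^ 2 * (jap v ^ (γ / 2) * g v) ^ 2 := by ring
      _ ≤ _ := by gcongr
  · simp [hv]

lemma aux_final (s γ T j : ℝ) (hj0 : 0 ≤ j)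
    (hJj : (∫⁻ z : EuclideanSpace ℝ (Fin 3),
      ENNReal.ofReal (min 1 (‖z‖ ^ 2) / ‖z‖ ^ (3 + 2 * s))) = ENNReal.ofReal j)
    (h : EuclideanSpace ℝ (Fin 3) → ℝ) (hh : Measurable h)
    (hl2 : ∀ v, h v ^ 2 ≤ T ^ 2 * (jap v ^ γ * h v ^ 2))
    (hpt : ∀ v w, (h v - h w) ^ 2 ≤ 2 * T ^ 2 *
        ((jap v ^ (γ / 2) * h v - jap w ^ (γ / 2) * h w) ^ 2 +
          (1 + -γ / 2) ^ 2 * ((jap v ^ (γ / 2) * h v) ^ 2 * min 1 (‖v - w‖ ^ 2)))) :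
    (∫⁻ v : EuclideanSpace ℝ (Fin 3), ENNReal.ofReal (h v ^ 2)) +
      (∫⁻ p : EuclideanSpace ℝ (Fin 3) × EuclideanSpace ℝ (Fin 3),
        ENNReal.ofReal ((h p.1 - h p.2) ^ 2 / ‖p.1 - p.2‖ ^ (3 + 2 * s))) ≤
    ENNReal.ofReal (T ^ 2 * (3 + 2 * (1 + -γ / 2) ^ 2 * j)) *
      ((∫⁻ v : EuclideanSpace ℝ (Fin 3), ENNReal.ofReal (jap v ^ γ * h v ^ 2)) +
      (∫⁻ p : EuclideanSpace ℝ (Fin 3) × EuclideanSpace ℝ (Fin 3),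
        ENNReal.ofReal ((jap p.1 ^ (γ / 2) * h p.1 - jap p.2 ^ (γ / 2) * h p.2) ^ 2 /
          ‖p.1 - p.2‖ ^ (3 + 2 * s)))) := by
  have hjm := aux_jap_meas
  set N1 := ∫⁻ v : EuclideanSpace ℝ (Fin 3), ENNReal.ofReal (jap v ^ γ * h v ^ 2) with hN1
  set N2 := ∫⁻ p : EuclideanSpace ℝ (Fin 3) × EuclideanSpace ℝ (Fin 3),
        ENNReal.ofReal ((jap p.1 ^ (γ / 2) * h p.1 - jap p.2 ^ (γ / 2) * h p.2) ^ 2 /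
          ‖p.1 - p.2‖ ^ (3 + 2 * s)) with hN2
  have hI1 : (∫⁻ v : EuclideanSpace ℝ (Fin 3), ENNReal.ofReal (h v ^ 2)) ≤
      ENNReal.ofReal (T ^ 2) * N1 := by
    rw [hN1, ← lintegral_const_mul _ (by fun_prop)]
    refine lintegral_mono fun v => ?_
    rw [← ENNReal.ofReal_mul (by positivity)]
    exact ENNReal.ofReal_le_ofReal (hl2 v)
  have hX : (∫⁻ p : EuclideanSpace ℝ (Fin 3) × EuclideanSpace ℝ (Fin 3),
      ENNReal.ofReal (jap p.1 ^ γ * h p.1 ^ 2) *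
        ENNReal.ofReal (min 1 (‖p.1 - p.2‖ ^ 2) / ‖p.1 - p.2‖ ^ (3 + 2 * s))) =
      N1 * ENNReal.ofReal j := by
    rw [Measure.volume_eq_prod, lintegral_prod _ (by fun_prop)]
    have : ∀ v : EuclideanSpace ℝ (Fin 3), (∫⁻ w : EuclideanSpace ℝ (Fin 3),
        ENNReal.ofReal (jap v ^ γ * h v ^ 2) *
        ENNReal.ofReal (min 1 (‖v - w‖ ^ 2) / ‖v - w‖ ^ (3 + 2 * s))) =
        ENNReal.ofReal (jap v ^ γ * h v ^ 2) * ENNReal.ofReal j := by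
      intro v
      rw [lintegral_const_mul _ (by fun_prop), ← hJj]
      congr 1
      exact lintegral_sub_left_eq_self (fun z : EuclideanSpace ℝ (Fin 3) =>
        ENNReal.ofReal (min 1 (‖z‖ ^ 2) / ‖z‖ ^ (3 + 2 * s))) v
    simp only [this]
    rw [lintegral_mul_const _ (by fun_prop)]
  have hI2 : (∫⁻ p : EuclideanSpace ℝ (Fin 3) × EuclideanSpace ℝ (Fin 3),
        ENNReal.ofReal ((h p.1 - h p.2) ^ 2 / ‖p.1 - p.2‖ ^ (3 + 2 * s))) ≤
      ENNReal.ofReal (2 * T ^ 2) *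
        (N2 + ENNReal.ofReal ((1 + -γ / 2) ^ 2) * (N1 * ENNReal.ofReal j)) := by
    rw [hN2, ← hX, ← lintegral_const_mul _ (by fun_prop), ← lintegral_add_left (by fun_prop),
      ← lintegral_const_mul _ (by fun_prop)]
    refine lintegral_mono fun p => ?_
    have hw : 0 ≤ jap p.1 ^ γ * h p.1 ^ 2 := by rw [← aux_sq]; positivity
    rw [← ENNReal.ofReal_mul hw, ← ENNReal.ofReal_mul (by positivity),
      ← ENNReal.ofReal_add (by positivity) (by positivity), ← ENNReal.ofReal_mul (by positivity)]
    apply ENNReal.ofReal_le_ofReal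
    rw [← aux_sq]
    calc _ ≤ _ := div_le_div_of_nonneg_right (hpt p.1 p.2) (by positivity)
      _ = _ := by ring
  calc _ ≤ ENNReal.ofReal (T ^ 2) * N1 + ENNReal.ofReal (2 * T ^ 2) *
        (N2 + ENNReal.ofReal ((1 + -γ / 2) ^ 2) * (N1 * ENNReal.ofReal j)) :=
        add_le_add hI1 hI2
    _ = ENNReal.ofReal (T ^ 2 + 2 * T ^ 2 * ((1 + -γ / 2) ^ 2 * j)) * N1 +
        ENNReal.ofReal (2 * T ^ 2) * N2 := by
      rw [ENNReal.ofReal_add (by positivity) (by positivity), ENNReal.ofReal_mul (p := 2 * T ^ 2)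
        (by positivity), ENNReal.ofReal_mul (p := (1 + -γ / 2) ^ 2) (by positivity)]
      ring
    _ ≤ _ := by
      rw [mul_add]
      have : 0 ≤ T ^ 2 * ((1 + -γ / 2) ^ 2 * j) := by positivity
      gcongr ENNReal.ofReal ?_ * _ + ENNReal.ofReal ?_ * _
      · nlinarith [sq_nonneg T]
      · nlinarith [sq_nonneg T]

/-- **Lower bound for the weighted fractional Sobolev norm on a ball** (Lemma B.1):
for `s ∈ (0,1)`, `γ < 0` there is `c > 0` such that, for every `R > 1` and every
measurable `g`, with `h = 1_{|v|≤R} g`,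
`‖h‖²_{H^s_{γ/2}} ≥ c R^{γ(2−s)} ‖h‖²_{H^s}`, where the `H^s` (semi)norms are taken in
the Gagliardo form. -/
theorem weighted_Hs_lower_bound
    (s γ : ℝ) (hs : s ∈ Set.Ioo (0:ℝ) 1) (hγ : γ < 0) :
    ∃ c : ℝ, 0 < c ∧
      ∀ R : ℝ, 1 < R → ∀ g : EuclideanSpace ℝ (Fin 3) → ℝ, Measurable g →
        ENNReal.ofReal (c * R ^ (γ * (2 - s))) *
            ((∫⁻ v : EuclideanSpace ℝ (Fin 3),
                ENNReal.ofReal ((if ‖v‖ ≤ R then g v else 0) ^ 2)) +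
              ∫⁻ p : EuclideanSpace ℝ (Fin 3) × EuclideanSpace ℝ (Fin 3),
                ENNReal.ofReal
                  (((if ‖p.1‖ ≤ R then g p.1 else 0) - (if ‖p.2‖ ≤ R then g p.2 else 0)) ^ 2 /
                    ‖p.1 - p.2‖ ^ (3 + 2 * s))) ≤
          (∫⁻ v : EuclideanSpace ℝ (Fin 3),
              ENNReal.ofReal (jap v ^ γ * (if ‖v‖ ≤ R then g v else 0) ^ 2)) +
            ∫⁻ p : EuclideanSpace ℝ (Fin 3) × EuclideanSpace ℝ (Fin 3),
              ENNReal.ofReal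
                ((jap p.1 ^ (γ / 2) * (if ‖p.1‖ ≤ R then g p.1 else 0) -
                    jap p.2 ^ (γ / 2) * (if ‖p.2‖ ≤ R then g p.2 else 0)) ^ 2 /
                  ‖p.1 - p.2‖ ^ (3 + 2 * s)) := by
  set J := (∫⁻ z : EuclideanSpace ℝ (Fin 3),
      ENNReal.ofReal (min 1 (‖z‖ ^ 2) / ‖z‖ ^ (3 + 2 * s))) with hJ
  have hJfin : J ≠ ⊤ := aux_phi_finite s hs
  set j := J.toReal with hj
  have hj0 : 0 ≤ j := ENNReal.toReal_nonneg
  have hJj : J = ENNReal.ofReal j := (ENNReal.ofReal_toReal hJfin).symm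
  set K := 3 + 2 * (1 + -γ / 2) ^ 2 * j with hK
  have hK0 : 0 < K := by positivity
  refine ⟨1 / ((2:ℝ) ^ (-γ) * K), by positivity, ?_⟩
  intro R hR g hg
  have hh : Measurable (fun v : EuclideanSpace ℝ (Fin 3) => if ‖v‖ ≤ R then g v else 0) :=
    Measurable.ite (measurableSet_le measurable_norm measurable_const) hg measurable_const
  set T := (2 * R) ^ (-γ / 2) with hT
  have hl2 := fun v => aux_l2 hγ hR g v
  have hpt := fun v w => aux_pointwise hγ hR g v w
  rw [← hT] at hl2 hpt
  have key := aux_final s γ T j hj0 hJj _ hh hl2 hpt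
  refine (mul_le_mul_right key _).trans ?_
  rw [← mul_assoc, ← ENNReal.ofReal_mul (by positivity)]
  refine mul_le_of_le_one_left zero_le ?_
  rw [ENNReal.ofReal_le_one]
  have hR0 : 0 < R := by linarith
  have hT2 : T ^ 2 = 2 ^ (-γ) * R ^ (-γ) := by
    rw [hT, ← Real.rpow_natCast, ← Real.rpow_mul (by linarith), ← Real.mul_rpow (by norm_num) hR0.le]
    congr 1
    push_cast
    ring
  have hle : R ^ (γ * (2 - s)) * R ^ (-γ) ≤ 1 := by
    rw [← Real.rpow_add hR0]
    exact Real.rpow_le_one_of_one_le_of_nonpos hR.le (by nlinarith [hs.2])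
  rw [hT2]
  have h2 : (0:ℝ) < 2 ^ (-γ) := by positivity
  calc _ = R ^ (γ * (2 - s)) * R ^ (-γ) := by
        rw [← hK]
        field_simp
    _ ≤ 1 := hle
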